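/- arXiv:1601.03436 — 4 statements merged into one kernel-verified Lean document; each statement's English description precedes it below -/
import Mathlib

section
/- Let R be an associative unital ring and M a left R-module that is projective in σ[M] and has finite uniform dimension. Then the following are equivalent: (a) M is a semiprime module and satisfies the ascending chain condition on left annihilators; (b) for every submodule N ≤ M, N is essential in M if and only if there exists an injective R-homomorphism M → N. -/
universe u v

section Defs

variable (R : Type u) [Ring R] (M : Type v) [AddCommGroup M] [Module R M]

/-- The product `K ·_M L` of submodules: the sum of all images `f K` over `f : M → L`. -/
def prodM (K L : Submodule R M) : Submodule R M :=
  ⨆ (f : M →ₗ[R] M) (_ : LinearMap.range f ≤ L), K.map f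

/-- A submodule is fully invariant if it is stable under every endomorphism. -/
def IsFullyInvariant (N : Submodule R M) : Prop :=
  ∀ f : M →ₗ[R] M, N.map f ≤ N

/-- A fully invariant submodule `N` is prime in `M` if `K ·_M L ≤ N` implies `K ≤ N` or
`L ≤ N` for all fully invariant submodules `K, L`. -/
def IsPrimeSubmodule (N : Submodule R M) : Prop :=
  IsFullyInvariant R M N ∧
    ∀ K L : Submodule R M, IsFullyInvariant R M K → IsFullyInvariant R M L →
      prodM R M K L ≤ N → K ≤ N ∨ L ≤ N

/-- A fully invariant submodule `N` is semiprime in `M` if `K ·_M K ≤ N` implies `K ≤ N`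
for every fully invariant submodule `K`. -/
def IsSemiprimeSubmodule (N : Submodule R M) : Prop :=
  IsFullyInvariant R M N ∧
    ∀ K : Submodule R M, IsFullyInvariant R M K → prodM R M K K ≤ N → K ≤ N

/-- `M` is a semiprime module if `⊥` is semiprime in `M`. -/
def IsSemiprimeModule : Prop := IsSemiprimeSubmodule R M ⊥

/-- `M` is a prime module if `⊥` is prime in `M`. -/
def IsPrimeModule : Prop := IsPrimeSubmodule R M ⊥

/-- A minimal prime submodule: prime and minimal among prime submodules. -/
def IsMinimalPrimeSubmodule (P : Submodule R M) : Prop :=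
  IsPrimeSubmodule R M P ∧ ∀ Q : Submodule R M, IsPrimeSubmodule R M Q → Q ≤ P → Q = P

/-- `X` is `M`-generated: a homomorphic image of a direct sum of copies of `M`. -/
def IsMGenerated (X : Type v) [AddCommGroup X] [Module R X] : Prop :=
  ∃ (ι : Type v) (f : (ι →₀ M) →ₗ[R] X), Function.Surjective f

/-- `X` belongs to `σ[M]`: isomorphic to a submodule of an `M`-generated module. -/
def InSigmaM (X : Type v) [AddCommGroup X] [Module R X] : Prop :=
  ∃ (Y : Type v) (_ : AddCommGroup Y) (_ : Module R Y),
    IsMGenerated R M Y ∧ ∃ g : X →ₗ[R] Y, Function.Injective g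

/-- `M` is projective in `σ[M]`. -/
def ProjectiveInSigmaM : Prop :=
  ∀ (A B : Type v) [AddCommGroup A] [Module R A] [AddCommGroup B] [Module R B],
    InSigmaM R M A → InSigmaM R M B →
      ∀ g : A →ₗ[R] B, Function.Surjective g →
        ∀ h : M →ₗ[R] B, ∃ f : M →ₗ[R] A, g ∘ₗ f = h

/-- `N` is essential in `M`. -/
def IsEssentialSub (N : Submodule R M) : Prop :=
  ∀ L : Submodule R M, L ≠ ⊥ → N ⊓ L ≠ ⊥

/-- `M` has finite uniform dimension: no infinite independent family of nonzero submodules. -/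
def HasFinUdim : Prop :=
  ¬ ∃ f : ℕ → Submodule R M, (∀ n, f n ≠ ⊥) ∧
      ∀ n, Disjoint (f n) (⨆ (m) (_ : m ≠ n), f m)

/-- A left annihilator in `M`: an intersection `⋂_{f ∈ X} ker f` with `X ⊆ End_R(M)`. -/
def IsLeftAnnihilatorSub (N : Submodule R M) : Prop :=
  ∃ X : Set (M →ₗ[R] M), N = ⨅ f ∈ X, LinearMap.ker f

/-- ACC on left annihilators. -/
def AccLeftAnnihilators : Prop :=
  ∀ a : ℕ → Submodule R M, (∀ n, IsLeftAnnihilatorSub R M (a n)) → Monotone a →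
    ∃ n, ∀ m, n ≤ m → a m = a n

/-- `M` is a Goldie module: ACC on left annihilators and finite uniform dimension. -/
def IsGoldieModule : Prop := AccLeftAnnihilators R M ∧ HasFinUdim R M

/-- `Ann_M(K) = ⋂ { ker f | f ∈ Hom_R(M, K) }`. -/
def annM (K : Submodule R M) : Submodule R M :=
  ⨅ (f : M →ₗ[R] M) (_ : LinearMap.range f ≤ K), LinearMap.ker f

/-- `N` is an annihilator submodule: `N = Ann_M(K)` for some nonzero submodule `K`. -/
def IsAnnihilatorSub (N : Submodule R M) : Prop :=
  ∃ K : Submodule R M, K ≠ ⊥ ∧ N = annM R M K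

/-- A submodule `U` is uniform: nonzero and every nonzero submodule of `U` is essential in `U`. -/
def IsUniformSub (U : Submodule R M) : Prop :=
  U ≠ ⊥ ∧ ∀ A B : Submodule R M, A ≤ U → B ≤ U → A ≠ ⊥ → B ≠ ⊥ → A ⊓ B ≠ ⊥

/-- A submodule `U` is monoform: nonzero and every nonzero homomorphism `L → U` from a
submodule `L ≤ U` is injective. -/
def IsMonoformSub (U : Submodule R M) : Prop :=
  U ≠ ⊥ ∧ ∀ L : Submodule R M, L ≤ U → ∀ f : L →ₗ[R] U, f ≠ 0 → Function.Injective f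

/-- `M` has enough monoforms: every nonzero submodule contains a monoform submodule. -/
def HasEnoughMonoforms : Prop :=
  ∀ N : Submodule R M, N ≠ ⊥ → ∃ U : Submodule R M, U ≤ N ∧ IsMonoformSub R M U

/-- `M` is weakly compressible. -/
def WeaklyCompressible : Prop :=
  ∀ N : Submodule R M, N ≠ ⊥ → ∃ f : M →ₗ[R] M, LinearMap.range f ≤ N ∧ f ∘ₗ f ≠ 0

/-- `M` is retractable: `Hom_R(M, N) ≠ 0` for every nonzero submodule `N`. -/
def Retractable : Prop :=
  ∀ N : Submodule R M, N ≠ ⊥ → ∃ f : M →ₗ[R] M, LinearMap.range f ≤ N ∧ f ≠ 0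

/-- Powers of a fully invariant submodule: `J^0 = ⊥`, `J^1 = J`, `J^(m+1) = J ·_M J^m`. -/
def fipow (J : Submodule R M) : ℕ → Submodule R M
  | 0 => ⊥
  | 1 => J
  | n + 2 => prodM R M J (fipow J (n + 1))

end Defs

section RingDefs

variable (S : Type*) [Ring S]

/-- A ring is semiprime: no nonzero two-sided ideal squares to zero. -/
def IsSemiprimeRing : Prop :=
  ∀ I : TwoSidedIdeal S, (∀ a ∈ I, ∀ b ∈ I, a * b = 0) → I = ⊥

/-- A ring is prime: `I · J = 0` forces `I = 0` or `J = 0` for two-sided ideals. -/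
def IsPrimeRing : Prop :=
  ∀ I J : TwoSidedIdeal S, (∀ a ∈ I, ∀ b ∈ J, a * b = 0) → I = ⊥ ∨ J = ⊥

/-- A right annihilator subset of `S`: `{ s | X s = 0 }` for some `X ⊆ S`. -/
def IsRightAnnihilatorSet (T : Set S) : Prop :=
  ∃ X : Set S, T = {s : S | ∀ x ∈ X, x * s = 0}

/-- ACC on right annihilators of the ring `S`. -/
def AccRightAnnihilators : Prop :=
  ∀ a : ℕ → Set S, (∀ n, IsRightAnnihilatorSet S (a n)) → (∀ n, a n ⊆ a (n + 1)) →
    ∃ n, ∀ m, n ≤ m → a m = a n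

/-- `S` is a right Goldie ring: ACC on right annihilators and finite uniform dimension
as a right `S`-module. -/
def IsRightGoldieRing : Prop :=
  AccRightAnnihilators S ∧ HasFinUdim Sᵐᵒᵖ S

end RingDefs

open Submodule LinearMap

section Helpers

variable {R : Type u} [Ring R] {M : Type v} [AddCommGroup M] [Module R M]

/-- A family indexed by a linear order is independent as soon as each member is disjoint from some
submodule containing all the preceding ones. -/
theorem iSupIndep_of_disjoint_of_lt {ι : Type*} [LinearOrder ι] (L B : ι → Submodule R M)
    (hd : ∀ k, Disjoint (L k) (B k)) (hle : ∀ j k, j < k → L j ≤ B k) : iSupIndep L := by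
  classical
  rw [iSupIndep_iff_finsetSum_eq_zero_imp_eq_zero]
  intro s
  induction s using Finset.induction_on_max with
  | empty => simp
  | insert a s hs ih =>
    intro v hv hsum
    have ha : a ∉ s := fun h => lt_irrefl _ (hs a h)
    rw [Finset.sum_insert ha] at hsum
    have hB : ∑ i ∈ s, v i ∈ B a :=
      sum_mem fun i hi => hle i a (hs i hi) (hv i (Finset.mem_insert_of_mem hi))
    have hva : v a = 0 := by
      refine disjoint_def.mp (hd a) _ (hv a (Finset.mem_insert_self _ _)) ?_
      rw [eq_neg_of_add_eq_zero_left hsum]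
      exact neg_mem hB
    rw [hva, zero_add] at hsum
    intro i hi
    rcases Finset.mem_insert.mp hi with rfl | hi
    · exact hva
    · exact ih v (fun i hi => hv i (Finset.mem_insert_of_mem hi)) hsum i hi

theorem HasFinUdim.not_disjoint_of_lt (hud : HasFinUdim R M) (L B : ℕ → Submodule R M)
    (hne : ∀ k, L k ≠ ⊥) (hd : ∀ k, Disjoint (L k) (B k))
    (hle : ∀ j k, j < k → L j ≤ B k) : False :=
  hud ⟨L, hne, iSupIndep_of_disjoint_of_lt L B hd hle⟩

theorem HasFinUdim.not_disjoint_of_gt (hud : HasFinUdim R M) (L B : ℕ → Submodule R M)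
    (hne : ∀ k, L k ≠ ⊥) (hd : ∀ k, Disjoint (L k) (B k))
    (hle : ∀ j k, k < j → L j ≤ B k) : False :=
  hud ⟨L, hne, iSupIndep_of_disjoint_of_lt (ι := ℕᵒᵈ) L B hd hle⟩

/-- With finite uniform dimension, the image of an injective endomorphism is essential. -/
theorem HasFinUdim.isEssentialSub_of_injective (hud : HasFinUdim R M) {N : Submodule R M}
    (f : M →ₗ[R] M) (hf : Function.Injective f) (hN : range f ≤ N) : IsEssentialSub R M N := by
  intro L hL hNL
  have hpow : ∀ k : ℕ, Function.Injective ⇑(f ^ k) := fun k => by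
    rw [Module.End.coe_pow]
    exact hf.iterate k
  refine hud.not_disjoint_of_gt (fun k => L.map (f ^ k)) (fun k => range (f ^ (k + 1))) ?_ ?_ ?_
  · intro k h
    exact hL (Submodule.map_injective_of_injective (hpow k) (h.trans (Submodule.map_bot _).symm))
  · intro k
    rw [disjoint_def]
    rintro _ ⟨x, hx, rfl⟩ ⟨y, hy⟩
    rw [pow_succ, Module.End.mul_apply] at hy
    have hxy : f y = x := hpow k hy
    have hx' : x ∈ N ⊓ L := ⟨hN (hxy ▸ mem_range_self f y), hx⟩
    rw [hNL, mem_bot] at hx'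
    rw [hx', map_zero]
  · rintro j k hjk _ ⟨x, -, rfl⟩
    obtain ⟨d, rfl⟩ := Nat.exists_eq_add_of_lt hjk
    refine ⟨(f ^ d) x, ?_⟩
    rw [← Module.End.mul_apply, ← pow_add, add_right_comm]

theorem InSigmaM.of_submodule {Y : Type v} [AddCommGroup Y] [Module R Y]
    (hY : IsMGenerated R M Y) (P : Submodule R Y) : InSigmaM R M P :=
  ⟨Y, _, _, hY, P.subtype, P.injective_subtype⟩

theorem isMGenerated_finsupp (ι : Type v) : IsMGenerated R M (ι →₀ M) :=
  ⟨ι, .id, Function.surjective_id⟩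

variable (R M) in
theorem isMGenerated_self : IsMGenerated R M M :=
  ⟨PUnit, Finsupp.lapply PUnit.unit, fun m =>
    ⟨Finsupp.single PUnit.unit m, by simp⟩⟩

variable (R M) in
theorem isMGenerated_prod : IsMGenerated R M (M × M) := by
  refine ⟨ULift Bool, (Finsupp.lapply ⟨true⟩).prod (Finsupp.lapply ⟨false⟩), fun m =>
    ⟨Finsupp.single ⟨true⟩ m.1 + Finsupp.single ⟨false⟩ m.2, ?_⟩⟩
  simp [LinearMap.prod_apply]

/-- If `M` is projective in `σ[M]`, a map into the image `q(P)` of a submodule `P` of an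
`M`-generated module lifts to a map into `P`. -/
theorem ProjectiveInSigmaM.exists_lift (hproj : ProjectiveInSigmaM R M) {Y : Type v}
    [AddCommGroup Y] [Module R Y] (hY : IsMGenerated R M Y) (P : Submodule R Y)
    (q : Y →ₗ[R] M) (f : M →ₗ[R] M) (hf : range f ≤ P.map q) :
    ∃ F : M →ₗ[R] Y, range F ≤ P ∧ q ∘ₗ F = f := by
  obtain ⟨F, hF⟩ := hproj P (P.map q) (.of_submodule hY P)
    (.of_submodule (isMGenerated_self R M) _) (q.submoduleMap P) (q.submoduleMap_surjective P)
    (f.codRestrict (P.map q) fun m => hf (mem_range_self f m))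
  refine ⟨P.subtype ∘ₗ F, ?_, ?_⟩
  · rintro _ ⟨m, rfl⟩
    exact (F m).2
  · ext m
    exact congrArg Subtype.val (LinearMap.congr_fun hF m)

theorem ProjectiveInSigmaM.exists_lift_map (hproj : ProjectiveInSigmaM R M) (K : Submodule R M)
    (g f : M →ₗ[R] M) (hf : range f ≤ K.map g) :
    ∃ h : M →ₗ[R] M, range h ≤ K ∧ g ∘ₗ h = f :=
  hproj.exists_lift (isMGenerated_self R M) K g f hf

theorem ProjectiveInSigmaM.exists_lift_range (hproj : ProjectiveInSigmaM R M)
    (g f : M →ₗ[R] M) (hf : range f ≤ range g) : ∃ h : M →ₗ[R] M, g ∘ₗ h = f := by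
  obtain ⟨h, -, hh⟩ := hproj.exists_lift_map ⊤ g f (by rwa [Submodule.map_top])
  exact ⟨h, hh⟩

theorem ProjectiveInSigmaM.exists_lift_iSup (hproj : ProjectiveInSigmaM R M) {ι : Type v}
    (N : ι → Submodule R M) (f : M →ₗ[R] M) (hf : range f ≤ ⨆ i, N i) :
    ∃ F : M →ₗ[R] (ι →₀ M), (∀ m i, F m i ∈ N i) ∧ ∀ m, f m = (F m).sum fun _ x => x := by
  let P : Submodule R (ι →₀ M) := ⨅ i, (N i).comap (Finsupp.lapply i)
  have hP : ∀ y, y ∈ P ↔ ∀ i, y i ∈ N i := fun y => by simp [P]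
  obtain ⟨F, hF, hFf⟩ := hproj.exists_lift (isMGenerated_finsupp ι) P
    (Finsupp.lsum ℕ fun _ => LinearMap.id) f <| hf.trans <| by
      intro x hx
      obtain ⟨y, hy, rfl⟩ := (mem_iSup_iff_exists_finsupp _ _).mp hx
      exact ⟨y, (hP y).mpr hy, by simp; rfl⟩
  refine ⟨F, fun m => (hP _).mp (hF (mem_range_self F m)), fun m => ?_⟩
  rw [← hFf]
  simp
  rfl

/-- Every map `M → L` kills `K`, that is, `K ·_M L = 0`. -/
def Kills (K L : Submodule R M) : Prop :=
  ∀ f : M →ₗ[R] M, range f ≤ L → K ≤ ker f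

theorem kills_iff_prodM_le_bot {K L : Submodule R M} : Kills K L ↔ prodM R M K L ≤ ⊥ := by
  simp only [Kills, prodM, iSup_le_iff, Submodule.map_le_iff_le_comap, LinearMap.ker]

theorem prodM_le_right (K L : Submodule R M) : prodM R M K L ≤ L :=
  iSup₂_le fun _ hf => (LinearMap.map_le_range).trans hf

theorem Kills.mono_right {K L L' : Submodule R M} (h : Kills K L) (hL : L' ≤ L) : Kills K L' :=
  fun f hf => h f (hf.trans hL)

theorem Kills.iSup_right (hproj : ProjectiveInSigmaM R M) {ι : Type v} {K : Submodule R M}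
    {N : ι → Submodule R M} (h : ∀ i, Kills K (N i)) : Kills K (⨆ i, N i) := by
  intro f hf m hm
  obtain ⟨F, hF, hFf⟩ := hproj.exists_lift_iSup N f hf
  have hzero : F m = 0 := by
    ext i
    refine h i (Finsupp.lapply i ∘ₗ F) ?_ hm
    rintro _ ⟨x, rfl⟩
    exact hF x i
  rw [mem_ker, hFf, hzero, Finsupp.sum_zero_index]

theorem Kills.map_right (hproj : ProjectiveInSigmaM R M) {K N : Submodule R M}
    (h : Kills K N) (g : M →ₗ[R] M) : Kills K (N.map g) := by
  intro f hf m hm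
  obtain ⟨F, hF, rfl⟩ := hproj.exists_lift_map N g f hf
  have hzero : F m = 0 := h F hF hm
  rw [mem_ker, comp_apply, hzero, map_zero]

theorem Kills.iSup_map_left {N : Submodule R M} (h : Kills N N) :
    Kills (⨆ g : M →ₗ[R] M, N.map g) N := by
  intro f hf
  refine iSup_le fun g => ?_
  rintro _ ⟨x, hx, rfl⟩
  exact h (f ∘ₗ g) ((range_comp_le_range g f).trans hf) hx

theorem isFullyInvariant_iSup_map (N : Submodule R M) :
    IsFullyInvariant R M (⨆ g : M →ₗ[R] M, N.map g) := by
  intro f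
  rw [Submodule.map_iSup]
  refine iSup_le fun g => ?_
  rw [← Submodule.map_comp]
  exact le_iSup (fun g : M →ₗ[R] M => N.map g) (f ∘ₗ g)

theorem IsSemiprimeModule.eq_bot_of_kills (hproj : ProjectiveInSigmaM R M)
    (hs : IsSemiprimeModule R M) {N : Submodule R M} (hN : Kills N N) : N = ⊥ := by
  have hK : Kills (⨆ g : M →ₗ[R] M, N.map g) (⨆ g : M →ₗ[R] M, N.map g) :=
    .iSup_right hproj fun g => hN.iSup_map_left.map_right hproj g
  have hle := hs.2 _ (isFullyInvariant_iSup_map N) (kills_iff_prodM_le_bot.mp hK)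
  refine le_bot_iff.mp (le_trans ?_ hle)
  simpa using le_iSup (fun g : M →ₗ[R] M => N.map g) LinearMap.id

theorem IsSemiprimeModule.exists_not_le_ker (hproj : ProjectiveInSigmaM R M)
    (hs : IsSemiprimeModule R M) {N : Submodule R M} (hN : N ≠ ⊥) :
    ∃ f : M →ₗ[R] M, range f ≤ N ∧ ¬ N ≤ ker f := by
  by_contra! h
  exact hN (hs.eq_bot_of_kills hproj h)

theorem IsSemiprimeModule.retractable (hproj : ProjectiveInSigmaM R M)
    (hs : IsSemiprimeModule R M) : Retractable R M := by
  intro N hN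
  obtain ⟨f, hf, hne⟩ := hs.exists_not_le_ker hproj hN
  refine ⟨f, hf, ?_⟩
  rintro rfl
  simp at hne

theorem isLeftAnnihilatorSub_ker (f : M →ₗ[R] M) : IsLeftAnnihilatorSub R M (ker f) :=
  ⟨{f}, by simp⟩

theorem AccLeftAnnihilators.wellFoundedGT (hacc : AccLeftAnnihilators R M) :
    WellFoundedGT {N : Submodule R M // IsLeftAnnihilatorSub R M N} := by
  rw [wellFoundedGT_iff_monotone_chain_condition]
  intro a
  obtain ⟨n, hn⟩ := hacc (fun n => a n) (fun n => (a n).2) fun _ _ h => a.monotone h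
  exact ⟨n, fun m hm => Subtype.ext (hn m hm).symm⟩

/-- In a semiprime module with ACC on left annihilators, every nonzero submodule contains the range
of a non-nilpotent endomorphism. -/
theorem IsSemiprimeModule.exists_not_isNilpotent (hproj : ProjectiveInSigmaM R M)
    (hs : IsSemiprimeModule R M) (hacc : AccLeftAnnihilators R M) {N : Submodule R M}
    (hN : N ≠ ⊥) : ∃ f : Module.End R M, range f ≤ N ∧ ¬ IsNilpotent f := by
  by_contra! hnil
  have := hacc.wellFoundedGT
  let S : Set {N : Submodule R M // IsLeftAnnihilatorSub R M N} :=
    {A | ∃ f : M →ₗ[R] M, range f ≤ N ∧ f ≠ 0 ∧ A = ⟨ker f, isLeftAnnihilatorSub_ker f⟩}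
  obtain ⟨f₀, hf₀, hf₀'⟩ := hs.retractable hproj N hN
  obtain ⟨_, ⟨f, hfN, hf, rfl⟩, hmax⟩ :=
    wellFounded_gt.has_min S ⟨_, f₀, hf₀, hf₀', rfl⟩
  have hker : ∀ g : M →ₗ[R] M, range g ≤ N → g ≠ 0 → ker f ≤ ker g → ker g ≤ ker f := by
    intro g hg hg0 hle
    by_contra hlt
    exact hmax ⟨ker g, isLeftAnnihilatorSub_ker g⟩ ⟨g, hg, hg0, rfl⟩ (lt_of_le_not_ge hle hlt)
  have hzero : ∀ h : M →ₗ[R] M, f ∘ₗ h ∘ₗ f = 0 := by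
    intro h
    let x : Module.End R M := f ∘ₗ h
    have hnilx : ∃ k, x ^ k * f = 0 := by
      obtain ⟨k, hk⟩ := hnil x ((range_comp_le_range h f).trans hfN)
      exact ⟨k, by rw [hk, zero_mul]⟩
    classical
    obtain ⟨k, hk⟩ : ∃ k, Nat.find hnilx = k + 1 := by
      refine Nat.exists_eq_succ_of_ne_zero fun h0 => hf ?_
      have := Nat.find_spec hnilx
      rwa [h0, pow_zero, one_mul] at this
    have hk1 : x ^ (k + 1) * f = 0 := hk ▸ Nat.find_spec hnilx
    have hk0 : x ^ k * f ≠ 0 := Nat.find_min hnilx (by omega)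
    have hrange : range (x ^ k * f) ≤ N := by
      cases k with
      | zero => simpa using hfN
      | succ k =>
        rw [pow_succ', mul_assoc]
        exact (range_comp_le_range _ x).trans ((range_comp_le_range h f).trans hfN)
    have hle := hker (x ^ k * f) hrange hk0 fun m hm => by
      rw [mem_ker, Module.End.mul_apply, mem_ker.mp hm, map_zero]
    ext m
    refine hle (x := h (f m)) ?_
    have := LinearMap.congr_fun hk1 m
    rwa [pow_succ] at this
  have hfr : range f ≠ ⊥ := fun h => hf (range_eq_bot.mp h)
  obtain ⟨g, hg, hgf⟩ := hs.exists_not_le_ker hproj hfr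
  obtain ⟨h, rfl⟩ := hproj.exists_lift_range f g hg
  refine hgf ?_
  rintro _ ⟨m, rfl⟩
  exact LinearMap.congr_fun (hzero h) m

theorem IsSemiprimeModule.exists_disjoint_range_ker (hproj : ProjectiveInSigmaM R M)
    (hs : IsSemiprimeModule R M) (hacc : AccLeftAnnihilators R M) {N : Submodule R M}
    (hN : N ≠ ⊥) :
    ∃ f : M →ₗ[R] M, range f ≤ N ∧ range f ≠ ⊥ ∧ Disjoint (range f) (ker f) := by
  obtain ⟨f, hfN, hf⟩ := hs.exists_not_isNilpotent hproj hacc hN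
  obtain ⟨n, hn⟩ := hacc (fun k => ker (f ^ k)) (fun k => isLeftAnnihilatorSub_ker _)
    f.iterateKer.monotone
  refine ⟨f ^ (n + 1), ?_, ?_, ?_⟩
  · rw [pow_succ']
    exact (range_comp_le_range _ f).trans hfN
  · exact fun h => hf ⟨n + 1, range_eq_bot.mp h⟩
  · rw [disjoint_def]
    rintro _ ⟨x, rfl⟩ hx
    rw [mem_ker, ← Module.End.mul_apply, ← pow_add, ← mem_ker] at hx
    have h1 := hn (n + 1 + (n + 1)) (by omega)
    have h2 := hn (n + 1) (by omega)
    rwa [h1, ← h2] at hx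

/-- In a semiprime Goldie module, every submodule `N` contains the range of an endomorphism whose
kernel meets `N` trivially. -/
theorem IsSemiprimeModule.exists_disjoint_ker (hproj : ProjectiveInSigmaM R M)
    (hud : HasFinUdim R M) (hs : IsSemiprimeModule R M) (hacc : AccLeftAnnihilators R M)
    (N : Submodule R M) : ∃ c : M →ₗ[R] M, range c ≤ N ∧ Disjoint N (ker c) := by
  by_contra hbad
  let Bad := {K : Submodule R M // ¬ ∃ c : M →ₗ[R] M, range c ≤ K ∧ Disjoint K (ker c)}
  have step : ∀ K : Bad, ∃ a : M →ₗ[R] M, range a ≤ K.1 ∧ range a ≠ ⊥ ∧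
      Disjoint (range a) (ker a) ∧
      ¬ ∃ c : M →ₗ[R] M, range c ≤ K.1 ⊓ ker a ∧ Disjoint (K.1 ⊓ ker a) (ker c) := by
    rintro ⟨K, hK⟩
    have hK0 : K ≠ ⊥ := by
      rintro rfl
      exact hK ⟨0, by simp, disjoint_bot_left⟩
    obtain ⟨a, haK, ha0, had⟩ := hs.exists_disjoint_range_ker hproj hacc hK0
    refine ⟨a, haK, ha0, had, ?_⟩
    rintro ⟨c, hc, hcd⟩
    refine hK ⟨a + c, ?_, ?_⟩
    · rintro _ ⟨m, rfl⟩
      exact add_mem (haK (mem_range_self a m)) (hc (mem_range_self c m)).1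
    · rw [disjoint_def]
      intro x hx hxac
      rw [mem_ker, LinearMap.add_apply] at hxac
      have hcx := (hc (mem_range_self c x)).2
      have hax : a x = 0 := by
        refine disjoint_def.mp had _ (mem_range_self a x) ?_
        rw [eq_neg_of_add_eq_zero_left hxac]
        exact neg_mem hcx
      rw [hax, zero_add] at hxac
      exact disjoint_def.mp hcd x ⟨hx, hax⟩ hxac
  choose a haK ha0 had hbad' using step
  let next : Bad → Bad := fun K => ⟨K.1 ⊓ ker (a K), hbad' K⟩
  let s : ℕ → Bad := fun k => next^[k] ⟨N, hbad⟩
  have hsucc : ∀ k, (s (k + 1)).1 = (s k).1 ⊓ ker (a (s k)) := fun k => by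
    simp only [s, Function.iterate_succ_apply', next]
  have hanti : Antitone fun k => (s k).1 :=
    antitone_nat_of_succ_le fun k => (hsucc k).le.trans inf_le_left
  exact hud.not_disjoint_of_gt (fun k => range (a (s k))) (fun k => ker (a (s k)))
    (fun k => ha0 _) (fun k => had _) fun j k hkj =>
      (haK (s j)).trans ((hanti hkj).trans ((hsucc k).le.trans inf_le_right))

theorem IsEssentialSub.comap_of_le {A B : Submodule R M}
    (hAB : ∀ L ≤ B, L ≠ ⊥ → A ⊓ L ≠ ⊥) (h : M →ₗ[R] M) (hh : range h ≤ B) :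
    IsEssentialSub R M (A.comap h) := by
  intro L hL
  by_cases h0 : L.map h = ⊥
  · have hle : L ≤ A.comap h := by
      rw [← Submodule.map_le_iff_le_comap, h0]
      exact bot_le
    rwa [inf_eq_right.mpr hle]
  · obtain ⟨_, ⟨hA, x, hx, rfl⟩, hne⟩ :=
      exists_mem_ne_zero_of_ne_bot (hAB _ (LinearMap.map_le_range.trans hh) h0)
    refine (Submodule.ne_bot_iff _).mpr ⟨x, ⟨hA, hx⟩, ?_⟩
    rintro rfl
    exact hne (map_zero h)

theorem IsEssentialSub.mono {A B : Submodule R M} (hA : IsEssentialSub R M A) (h : A ≤ B) :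
    IsEssentialSub R M B :=
  fun L hL hB => hA L hL (le_bot_iff.mp ((inf_le_inf_right L h).trans hB.le))

theorem exists_disjoint_isEssentialSub_sup (T : Submodule R M) :
    ∃ C : Submodule R M, Disjoint T C ∧ IsEssentialSub R M (T ⊔ C) := by
  obtain ⟨C, hC⟩ := zorn_le₀ {C : Submodule R M | Disjoint T C} fun c hc hchain =>
    ⟨sSup c, hchain.directedOn.disjoint_sSup_right.mpr hc, fun _ => le_sSup⟩
  refine ⟨C, hC.prop, fun L hL hbot => hL ?_⟩
  have hd : Disjoint T (C ⊔ L) :=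
    hC.prop.disjoint_sup_right_of_disjoint_sup_left (disjoint_iff.mpr hbot)
  have hLC : L ≤ C := le_sup_right.trans (hC.le_of_ge hd le_sup_left)
  rw [← le_bot_iff, ← hbot]
  exact le_inf (hLC.trans le_sup_right) le_rfl

/-- If every essential submodule contains a copy of `M`, then `M` is semiprime. -/
theorem isSemiprimeModule_of_exists_injective (hproj : ProjectiveInSigmaM R M)
    (hmono : ∀ N : Submodule R M, IsEssentialSub R M N →
      ∃ f : M →ₗ[R] M, range f ≤ N ∧ Function.Injective f) : IsSemiprimeModule R M := by
  refine ⟨fun f => by simp, fun K _ hKK => ?_⟩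
  rw [← kills_iff_prodM_le_bot] at hKK
  have hA : Kills K (⨆ L : {L : Submodule R M // Kills K L}, L.1) :=
    .iSup_right hproj fun L => L.2
  obtain ⟨f, hf, hinj⟩ := hmono (⨆ L : {L : Submodule R M // Kills K L}, L.1) <| by
    intro L hL
    by_cases hKL : Kills K L
    · rwa [inf_eq_right.mpr (le_iSup (fun L : {L : Submodule R M // Kills K L} => L.1) ⟨L, hKL⟩)]
    · have hprod : Kills K (prodM R M K L) :=
        (Kills.iSup_right hproj fun g : M →ₗ[R] M => hKK.map_right hproj g).mono_right
          (iSup_mono fun g => iSup_le fun _ => le_rfl)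
      intro hbot
      refine hKL (kills_iff_prodM_le_bot.mpr (hbot ▸ le_inf ?_ (prodM_le_right K L)))
      exact le_iSup (fun L : {L : Submodule R M // Kills K L} => L.1) ⟨_, hprod⟩
  exact (hA f hf).trans (ker_eq_bot.mpr hinj).le

/-- If every essential submodule contains a copy of `M`, then `M` has no nonzero endomorphism with
essential kernel. -/
theorem eq_zero_of_isEssentialSub_ker (hproj : ProjectiveInSigmaM R M) (hud : HasFinUdim R M)
    (hmono : ∀ N : Submodule R M, IsEssentialSub R M N →
      ∃ f : M →ₗ[R] M, range f ≤ N ∧ Function.Injective f)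
    (f : M →ₗ[R] M) (hf : IsEssentialSub R M (ker f)) : f = 0 := by
  obtain ⟨C, hdisj, hess⟩ := exists_disjoint_isEssentialSub_sup (range f)
  obtain ⟨φ, hφ, hinj⟩ := hmono _ hess
  obtain ⟨F, hF, hFφ⟩ := hproj.exists_lift (isMGenerated_prod R M) ((⊤ : Submodule R M).prod C)
    (f.coprod LinearMap.id) φ <| hφ.trans <| sup_le
      (by rintro _ ⟨x, rfl⟩; exact ⟨(x, 0), by simp, by simp⟩)
      (fun x hx => ⟨(0, x), by simpa using hx, by simp⟩)
  let h : M →ₗ[R] M := LinearMap.fst R M M ∘ₗ F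
  let ψ : M →ₗ[R] M := LinearMap.snd R M M ∘ₗ F
  have hφ' : ∀ x, φ x = f (h x) + ψ x := fun x => by
    rw [← hFφ]
    simp [h, ψ]
  have hψC : range ψ ≤ C := by
    rintro _ ⟨x, rfl⟩
    exact (hF (mem_range_self F x)).2
  have hE : IsEssentialSub R M ((ker f).comap h) :=
    IsEssentialSub.comap_of_le (B := ⊤) (fun L _ hL => hf L hL) h le_top
  have hψ : Function.Injective ψ := by
    rw [← ker_eq_bot]
    by_contra hne
    refine hE _ hne (eq_bot_iff.mpr ?_)
    rintro x ⟨hx, hx'⟩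
    refine hinj ?_
    rw [map_zero, hφ', mem_ker.mp hx', mem_ker.mp (mem_comap.mp hx), add_zero]
  have hC := hud.isEssentialSub_of_injective ψ hψ hψC
  by_contra hf0
  exact hC (range f) (fun h => hf0 (range_eq_bot.mp h)) hdisj.symm.eq_bot

/-- With finite uniform dimension, in an ascending chain of submodules some term is essential in all
later ones. -/
theorem HasFinUdim.exists_essential_of_monotone (hud : HasFinUdim R M) (a : ℕ → Submodule R M)
    (ha : Monotone a) : ∃ n, ∀ m, n ≤ m → ∀ L ≤ a m, L ≠ ⊥ → a n ⊓ L ≠ ⊥ := by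
  by_contra! h
  choose m hm L hLa hL hdisj using h
  let s : ℕ → ℕ := fun k => m^[k] 0
  have hsucc : ∀ k, s (k + 1) = m (s k) := fun k => Function.iterate_succ_apply' m k 0
  have hs : Monotone s := monotone_nat_of_le_succ fun k => (hm (s k)).trans (hsucc k).ge
  refine hud.not_disjoint_of_lt (fun k => L (s k)) (fun k => a (s k)) (fun k => hL _)
    (fun k => (disjoint_iff.mpr (hdisj _)).symm) fun j k hjk => (hLa (s j)).trans (ha ?_)
  rw [← hsucc]
  exact hs hjk

/-- A retractable module of finite uniform dimension, projective in `σ[M]` and without nonzero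
endomorphisms with essential kernel, satisfies ACC on left annihilators. -/
theorem accLeftAnnihilators_of_eq_zero_of_isEssentialSub_ker (hproj : ProjectiveInSigmaM R M)
    (hud : HasFinUdim R M) (hret : Retractable R M)
    (hns : ∀ f : M →ₗ[R] M, IsEssentialSub R M (ker f) → f = 0) : AccLeftAnnihilators R M := by
  intro a hann ha
  obtain ⟨n, hn⟩ := hud.exists_essential_of_monotone a ha
  refine ⟨n, fun m hm => le_antisymm ?_ (ha hm)⟩
  obtain ⟨X, hX⟩ := hann n
  have hle : ∀ f ∈ X, a m ≤ ker f := by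
    intro f hf
    have hnf : a n ≤ ker f := hX.le.trans (iInf₂_le f hf)
    suffices h : (a m).map f = ⊥ by
      rw [LinearMap.ker, ← Submodule.map_le_iff_le_comap, h]
    by_contra hne
    obtain ⟨g, hg, hg0⟩ := hret _ hne
    obtain ⟨h, hh, rfl⟩ := hproj.exists_lift_map (a m) f g hg
    refine hg0 (hns _ ((IsEssentialSub.comap_of_le (hn m hm) h hh).mono ?_))
    intro x hx
    exact hnf (mem_comap.mp hx)
  exact (le_iInf₂ hle).trans hX.ge

theorem exists_injective_iff_exists_range_le {N : Submodule R M} :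
    (∃ f : M →ₗ[R] N, Function.Injective f) ↔
      ∃ f : M →ₗ[R] M, range f ≤ N ∧ Function.Injective f := by
  constructor
  · rintro ⟨f, hf⟩
    refine ⟨N.subtype ∘ₗ f, ?_, N.injective_subtype.comp hf⟩
    rintro _ ⟨x, rfl⟩
    exact (f x).2
  · rintro ⟨f, hfN, hf⟩
    exact ⟨f.codRestrict N fun x => hfN (mem_range_self f x),
      fun x y h => hf (congrArg Subtype.val h)⟩

end Helpers

/-- For `M` projective in `σ[M]` with finite uniform dimension:
`M` semiprime with ACC on left annihilators iff essential submodules are exactly those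
admitting a monomorphism from `M`. -/
theorem stmt0 (R : Type u) [Ring R] (M : Type v) [AddCommGroup M] [Module R M]
    (hproj : ProjectiveInSigmaM R M) (hud : HasFinUdim R M) :
    (IsSemiprimeModule R M ∧ AccLeftAnnihilators R M) ↔
      ∀ N : Submodule R M,
        IsEssentialSub R M N ↔ ∃ f : M →ₗ[R] N, Function.Injective f := by
  simp only [exists_injective_iff_exists_range_le]
  constructor
  · rintro ⟨hs, hacc⟩ N
    refine ⟨fun hN => ?_, fun ⟨f, hfN, hf⟩ => hud.isEssentialSub_of_injective f hf hfN⟩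
    obtain ⟨c, hcN, hc⟩ := hs.exists_disjoint_ker hproj hud hacc N
    refine ⟨c, hcN, ker_eq_bot.mp ?_⟩
    by_contra hne
    exact hN _ hne hc.eq_bot
  · intro h
    have hmono := fun N => (h N).mp
    have hs := isSemiprimeModule_of_exists_injective hproj hmono
    exact ⟨hs, accLeftAnnihilators_of_eq_zero_of_isEssentialSub_ker hproj hud
      (hs.retractable hproj) (eq_zero_of_isEssentialSub_ker hproj hud hmono)⟩
end

section
/- Let R be an associative unital ring and M a left R-module that is projective in σ[M]. Then M is a semiprime Goldie module if and only if M is weakly compressible, M has finite uniform dimension, and Hom_R(M/N, M) = 0 for every essential submodule N ≤_e M. -/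
universe u v

section Sigma

variable {R : Type u} [Ring R] {M : Type v} [AddCommGroup M] [Module R M]

theorem inSigmaM_finsupp_submodule (ι : Type v) (N : Submodule R M) :
    InSigmaM R M (ι →₀ N) :=
  ⟨ι →₀ M, inferInstance, inferInstance, ⟨ι, LinearMap.id, Function.surjective_id⟩,
    Finsupp.mapRange.linearMap N.subtype,
    Finsupp.mapRange_injective _ (map_zero _) N.injective_subtype⟩

theorem inSigmaM_submodule (N : Submodule R M) : InSigmaM R M N :=
  ⟨M, inferInstance, inferInstance,
    ⟨PUnit, Finsupp.lapply PUnit.unit, fun x => ⟨Finsupp.single PUnit.unit x, by simp⟩⟩,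
    N.subtype, N.injective_subtype⟩

/-- Maps into `M` with image inside the image of `g : A → M` factor through `g`. -/
theorem ProjectiveInSigmaM.exists_comp_eq (hproj : ProjectiveInSigmaM R M) {A : Type v}
    [AddCommGroup A] [Module R A] (hA : InSigmaM R M A) (g : A →ₗ[R] M) (h : M →ₗ[R] M)
    (hgh : LinearMap.range h ≤ LinearMap.range g) : ∃ f : M →ₗ[R] A, g ∘ₗ f = h := by
  obtain ⟨f, hf⟩ := hproj A (LinearMap.range g) hA (inSigmaM_submodule _) g.rangeRestrict
    g.surjective_rangeRestrict (h.codRestrict _ fun x => hgh ⟨x, rfl⟩)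
  refine ⟨f, LinearMap.ext fun x => ?_⟩
  exact congrArg Subtype.val (LinearMap.congr_fun hf x)

theorem ProjectiveInSigmaM.exists_map_into_submodule (hproj : ProjectiveInSigmaM R M)
    (B : Submodule R M) (f h : M →ₗ[R] M) (hh : LinearMap.range h ≤ B.map f) :
    ∃ g : M →ₗ[R] M, LinearMap.range g ≤ B ∧ f ∘ₗ g = h := by
  obtain ⟨g, hg⟩ := hproj.exists_comp_eq (inSigmaM_submodule B) (f ∘ₗ B.subtype) h
    (by rwa [LinearMap.range_comp, Submodule.range_subtype])
  refine ⟨B.subtype ∘ₗ g, ?_, hg⟩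
  rintro _ ⟨x, rfl⟩
  exact (g x).2

end Sigma

section Semiprime

variable {R : Type u} [Ring R] {M : Type v} [AddCommGroup M] [Module R M]

theorem IsSemiprimeModule.exists_map_ne_bot (hproj : ProjectiveInSigmaM R M)
    (hs : IsSemiprimeModule R M) {N : Submodule R M} (hN : N ≠ ⊥) :
    ∃ f : M →ₗ[R] M, LinearMap.range f ≤ N ∧ N.map f ≠ ⊥ := by
  by_contra! hzero
  let K : Submodule R M := ⨆ h : M →ₗ[R] M, N.map h
  have hNK : N ≤ K := by simpa using le_iSup (fun h : M →ₗ[R] M => N.map h) LinearMap.id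
  have hK : IsFullyInvariant R M K := by
    intro f
    rw [Submodule.map_iSup]
    refine iSup_le fun h => ?_
    rw [← Submodule.map_comp]
    exact le_iSup (fun h : M →ₗ[R] M => N.map h) (f ∘ₗ h)
  let φ : ((M →ₗ[R] M) →₀ N) →ₗ[R] M :=
    Finsupp.lsum ℕ fun h : M →ₗ[R] M => h ∘ₗ N.subtype
  have hφ : K ≤ LinearMap.range φ := by
    refine iSup_le fun h => ?_
    rintro _ ⟨x, hx, rfl⟩
    exact ⟨Finsupp.single h ⟨x, hx⟩, by simp [φ]⟩
  have hNK0 : ∀ g : M →ₗ[R] M, LinearMap.range g ≤ K → ∀ x ∈ N, g x = 0 := by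
    intro g hg x hx
    obtain ⟨f, rfl⟩ := hproj.exists_comp_eq (inSigmaM_finsupp_submodule _ N) φ g (hg.trans hφ)
    have hf : f x = 0 := by
      ext h
      have h0 := hzero (N.subtype ∘ₗ Finsupp.lapply h ∘ₗ f) (by
        rintro _ ⟨y, rfl⟩
        exact (f y h).2)
      exact (Submodule.eq_bot_iff _).1 h0 _ ⟨x, hx, rfl⟩
    simp [hf]
  refine hN (le_bot_iff.1 (hNK.trans (hs.2 K hK (iSup₂_le fun g hg => ?_))))
  rw [Submodule.map_iSup]
  refine iSup_le fun h => ?_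
  rintro _ ⟨_, ⟨x, hx, rfl⟩, rfl⟩
  exact hNK0 (g ∘ₗ h) ((LinearMap.range_comp_le_range h g).trans hg) x hx

/-- The endomorphism ring of a semiprime module is semiprime. -/
theorem IsSemiprimeModule.eq_zero_of_comp_comp_eq_zero (hproj : ProjectiveInSigmaM R M)
    (hs : IsSemiprimeModule R M) {f : M →ₗ[R] M} (hf : ∀ s : M →ₗ[R] M, f ∘ₗ s ∘ₗ f = 0) :
    f = 0 := by
  by_contra hne
  obtain ⟨h, hh, hne'⟩ := hs.exists_map_ne_bot hproj (mt LinearMap.range_eq_bot.1 hne)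
  obtain ⟨g, -, rfl⟩ := hproj.exists_map_into_submodule ⊤ f h (by rwa [Submodule.map_top])
  apply hne'
  rw [← LinearMap.range_comp, LinearMap.comp_assoc, hf g, LinearMap.range_zero]

theorem IsSemiprimeModule.weaklyCompressible (hproj : ProjectiveInSigmaM R M)
    (hs : IsSemiprimeModule R M) : WeaklyCompressible R M := by
  intro N hN
  by_contra! hsq
  obtain ⟨a, ha, hne⟩ := hs.exists_map_ne_bot hproj hN
  suffices a = 0 from hne (by rw [this, Submodule.map_zero])
  refine hs.eq_zero_of_comp_comp_eq_zero hproj fun s => ?_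
  have h₁ : a ∘ₗ a = 0 := hsq a ha
  have has : LinearMap.range (a ∘ₗ s) ≤ N := (LinearMap.range_comp_le_range s a).trans ha
  have h₂ := hsq (a ∘ₗ s) has
  have h₃ := hsq (a + a ∘ₗ s) (by
    rintro _ ⟨x, rfl⟩
    exact N.add_mem (ha ⟨x, rfl⟩) (has ⟨x, rfl⟩))
  ext x
  have e₁ : ∀ y, a (a y) = 0 := LinearMap.congr_fun h₁
  have e₂ : a (s (a (s x))) = 0 := LinearMap.congr_fun h₂ x
  have e₃ := LinearMap.congr_fun h₃ x
  simpa [e₁, e₂] using e₃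

theorem WeaklyCompressible.isSemiprimeModule (hw : WeaklyCompressible R M) :
    IsSemiprimeModule R M := by
  refine ⟨fun f => by simp, fun K _ hKK => ?_⟩
  by_contra hne
  obtain ⟨f, hf, hff⟩ := hw K (mt le_of_eq hne)
  refine hff (LinearMap.ext fun x => ?_)
  exact hKK (le_iSup₂_of_le (f := fun (f : M →ₗ[R] M) (_ : LinearMap.range f ≤ K) => K.map f)
    f hf le_rfl ⟨f x, hf ⟨x, rfl⟩, rfl⟩)

end Semiprime

section Goldie

variable {R : Type u} [Ring R] {M : Type v} [AddCommGroup M] [Module R M]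

theorem isEssentialSub_comap (s : M →ₗ[R] M) {A B : Submodule R M}
    (hs : LinearMap.range s ≤ B) (hA : ∀ L : Submodule R M, L ≤ B → L ≠ ⊥ → A ⊓ L ≠ ⊥) :
    IsEssentialSub R M (A.comap s) := by
  intro L hL
  by_cases h0 : L.map s = ⊥
  · have hle : L ≤ A.comap s := by
      rw [← Submodule.map_le_iff_le_comap, h0]
      exact bot_le
    rwa [inf_eq_right.2 hle]
  · obtain ⟨_, ⟨hyA, x, hx, rfl⟩, hne⟩ := (Submodule.ne_bot_iff _).1
      (hA (L.map s) (LinearMap.map_le_range.trans hs) h0)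
    exact (Submodule.ne_bot_iff _).2 ⟨x, ⟨hyA, hx⟩, fun hx0 => hne (by rw [hx0, map_zero])⟩

theorem AccLeftAnnihilators.exists_maximal_ker (hacc : AccLeftAnnihilators R M)
    {Z : Set (M →ₗ[R] M)} (hZ : Z.Nonempty) :
    ∃ f ∈ Z, ∀ g ∈ Z, ¬ LinearMap.ker f < LinearMap.ker g := by
  by_contra! h
  choose! F hFZ hlt using h
  obtain ⟨f₀, hf₀⟩ := hZ
  have hmem : ∀ n, F^[n] f₀ ∈ Z := by
    intro n
    induction n with
    | zero => exact hf₀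
    | succ n ih =>
      rw [Function.iterate_succ_apply']
      exact hFZ _ ih
  have hmono : StrictMono fun n => LinearMap.ker (F^[n] f₀) := by
    refine strictMono_nat_of_lt_succ fun n => ?_
    rw [Function.iterate_succ_apply']
    exact hlt _ (hmem n)
  obtain ⟨n, hn⟩ := hacc _ (fun n => ⟨{F^[n] f₀}, by simp⟩) hmono.monotone
  exact (hmono n.lt_succ_self).ne' (hn _ n.le_succ)

theorem IsSemiprimeModule.eq_zero_of_isEssentialSub_ker (hproj : ProjectiveInSigmaM R M)
    (hs : IsSemiprimeModule R M) (hacc : AccLeftAnnihilators R M) (f : M →ₗ[R] M)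
    (hf : IsEssentialSub R M (LinearMap.ker f)) : f = 0 := by
  by_contra hne
  obtain ⟨f, ⟨hf, hne⟩, hmax⟩ := hacc.exists_maximal_ker
    (Z := {f | IsEssentialSub R M (LinearMap.ker f) ∧ f ≠ 0}) ⟨f, hf, hne⟩
  refine hne (hs.eq_zero_of_comp_comp_eq_zero hproj fun s => ?_)
  by_contra hne'
  have hle : LinearMap.ker f ≤ LinearMap.ker (f ∘ₗ s ∘ₗ f) :=
    LinearMap.ker_le_ker_comp f (f ∘ₗ s)
  have hess : IsEssentialSub R M (LinearMap.ker (f ∘ₗ s ∘ₗ f)) := fun L hL h =>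
    hf L hL (le_bot_iff.1 ((inf_le_inf_right L hle).trans h.le))
  refine hmax _ ⟨hess, hne'⟩ (lt_of_le_of_ne hle fun heq => ?_)
  have hfs : IsEssentialSub R M ((LinearMap.ker f).comap s) :=
    isEssentialSub_comap s le_top fun L _ => hf L
  obtain ⟨_, ⟨hy, x, rfl⟩, hx⟩ := (Submodule.ne_bot_iff _).1
    (hfs _ (mt LinearMap.range_eq_bot.1 hne))
  have hxker : x ∈ LinearMap.ker (f ∘ₗ s ∘ₗ f) := hy
  rw [← heq] at hxker
  exact hx hxker

/-- A strict inclusion of left annihilators is never essential. -/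
theorem IsLeftAnnihilatorSub.exists_disjoint_of_lt (hproj : ProjectiveInSigmaM R M)
    (hw : WeaklyCompressible R M)
    (hess : ∀ f : M →ₗ[R] M, IsEssentialSub R M (LinearMap.ker f) → f = 0)
    {A B : Submodule R M} (hA : IsLeftAnnihilatorSub R M A) (hAB : A < B) :
    ∃ L ≤ B, L ≠ ⊥ ∧ A ⊓ L = ⊥ := by
  by_contra! hL
  obtain ⟨X, rfl⟩ := hA
  refine hAB.not_ge (le_iInf₂ fun f hf => ?_)
  rw [LinearMap.le_ker_iff_map]
  by_contra hne
  obtain ⟨h, hh, hhh⟩ := hw _ hne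
  obtain ⟨g, hg, rfl⟩ := hproj.exists_map_into_submodule B f h hh
  suffices f ∘ₗ g = 0 from hhh (by rw [this, LinearMap.zero_comp])
  refine hess _ fun L hL0 h0 =>
    isEssentialSub_comap g hg hL L hL0 (le_bot_iff.1 (le_trans ?_ h0.le))
  rw [LinearMap.ker_comp]
  exact inf_le_inf_right L (Submodule.comap_mono (iInf₂_le f hf))

theorem iSupIndep_of_disjoint_chain {B f : ℕ → Submodule R M} (hB : Monotone B)
    (hf : ∀ n, f n ≤ B (n + 1)) (hd : ∀ n, Disjoint (B n) (f n)) : iSupIndep f := by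
  rw [iSupIndep_iff_finsetSum_eq_zero_imp_eq_zero]
  intro s
  induction s using Finset.induction_on_max with
  | empty => simp
  | insert a s hs ih =>
    intro v hv hsum
    have has : a ∉ s := fun h => (hs a h).false
    rw [Finset.sum_insert has] at hsum
    have hmem : ∑ i ∈ s, v i ∈ B a := Submodule.sum_mem _ fun i hi =>
      hB (Nat.succ_le_of_lt (hs i hi)) (hf i (hv i (Finset.mem_insert_of_mem hi)))
    have hva : v a = 0 := by
      refine Submodule.disjoint_def.1 (hd a) _ ?_ (hv a (Finset.mem_insert_self a s))
      rw [eq_neg_of_add_eq_zero_left hsum]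
      exact neg_mem hmem
    rw [hva, zero_add] at hsum
    intro i hi
    rcases Finset.mem_insert.1 hi with rfl | hi
    · exact hva
    · exact ih v (fun j hj => hv j (Finset.mem_insert_of_mem hj)) hsum i hi

theorem HasFinUdim.accLeftAnnihilators (hu : HasFinUdim R M) (hproj : ProjectiveInSigmaM R M)
    (hw : WeaklyCompressible R M)
    (hess : ∀ f : M →ₗ[R] M, IsEssentialSub R M (LinearMap.ker f) → f = 0) :
    AccLeftAnnihilators R M := by
  intro a ha hmono
  by_contra! hne
  choose g hg hag using hne
  have hlt : ∀ n, a n < a (g n) := fun n => (hmono (hg n)).lt_of_ne (hag n).symm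
  choose L hLle hL0 hLd using fun n => (ha n).exists_disjoint_of_lt hproj hw hess (hlt n)
  have hB : Monotone fun k => a (g^[k] 0) := by
    refine monotone_nat_of_le_succ fun k => ?_
    rw [Function.iterate_succ_apply']
    exact (hlt _).le
  refine hu ⟨fun k => L (g^[k] 0), fun k => hL0 _, iSupIndep_of_disjoint_chain hB (fun k => ?_)
    fun k => disjoint_iff.2 (hLd _)⟩
  rw [Function.iterate_succ_apply']
  exact hLle _

end Goldie

/-- `M` is a semiprime Goldie module iff `M` is weakly compressible with
finite uniform dimension and `Hom_R(M/N, M) = 0` for every essential `N ≤ M`. -/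
theorem stmt2 (R : Type u) [Ring R] (M : Type v) [AddCommGroup M] [Module R M]
    (hproj : ProjectiveInSigmaM R M) :
    (IsSemiprimeModule R M ∧ IsGoldieModule R M) ↔
      (WeaklyCompressible R M ∧ HasFinUdim R M ∧
        ∀ N : Submodule R M, IsEssentialSub R M N →
          ∀ f : (M ⧸ N) →ₗ[R] M, f = 0) := by
  constructor
  · rintro ⟨hs, hacc, hu⟩
    refine ⟨hs.weaklyCompressible hproj, hu, fun N hN f => ?_⟩
    have hle : N ≤ LinearMap.ker (f ∘ₗ N.mkQ) := by
      intro x hx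
      simp [(Submodule.Quotient.mk_eq_zero N).2 hx]
    have h0 : f ∘ₗ N.mkQ = 0 := hs.eq_zero_of_isEssentialSub_ker hproj hacc _ fun L hL h =>
      hN L hL (le_bot_iff.1 ((inf_le_inf_right L hle).trans h.le))
    exact Submodule.linearMap_qext N h0
  · rintro ⟨hw, hu, hess⟩
    refine ⟨hw.isSemiprimeModule, hu.accLeftAnnihilators hproj hw fun f hf => ?_, hu⟩
    rw [← (LinearMap.ker f).liftQ_mkQ f le_rfl,
      hess _ hf ((LinearMap.ker f).liftQ f le_rfl), LinearMap.zero_comp]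
end

section
/- Let R be an associative unital ring and M a left R-module that is projective in σ[M] and retractable. Then End_R(M) is a semiprime ring if and only if M is a semiprime module. -/
universe u v

theorem inSigmaM_finsupp (R : Type u) [Ring R] (M : Type v) [AddCommGroup M] [Module R M]
    (ι : Type v) : InSigmaM R M (ι →₀ M) :=
  ⟨ι →₀ M, inferInstance, inferInstance,
    ⟨ι, LinearMap.id, Function.surjective_id⟩, LinearMap.id, Function.injective_id⟩

theorem inSigmaM_submodule_s6 (R : Type u) [Ring R] (M : Type v) [AddCommGroup M] [Module R M]
    (N : Submodule R M) : InSigmaM R M N :=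
  ⟨M, inferInstance, inferInstance,
    ⟨PUnit, Finsupp.lapply PUnit.unit, fun m => ⟨Finsupp.single PUnit.unit m, by simp⟩⟩,
    N.subtype, N.injective_subtype⟩

theorem prodM_le_iff (R : Type u) [Ring R] (M : Type v) [AddCommGroup M] [Module R M]
    (K L N : Submodule R M) :
    prodM R M K L ≤ N ↔ ∀ f : M →ₗ[R] M, LinearMap.range f ≤ L → K.map f ≤ N := by
  simp only [prodM, iSup_le_iff]

/-- The two-sided ideal of endomorphisms with image in a fully invariant submodule. -/
def homIdeal (R : Type u) [Ring R] (M : Type v) [AddCommGroup M] [Module R M]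
    (K : Submodule R M) (hK : IsFullyInvariant R M K) : TwoSidedIdeal (Module.End R M) :=
  TwoSidedIdeal.mk' {f | ∀ m, f m ∈ K} (fun _ => K.zero_mem)
    (fun hf hg m => K.add_mem (hf m) (hg m)) (fun hf m => K.neg_mem (hf m))
    (fun {f _} hg m => hK f (Submodule.mem_map_of_mem (hg m))) (fun {_ g} hf m => hf (g m))

theorem mem_homIdeal (R : Type u) [Ring R] (M : Type v) [AddCommGroup M] [Module R M]
    (K : Submodule R M) (hK : IsFullyInvariant R M K) (f : Module.End R M) :
    f ∈ homIdeal R M K hK ↔ ∀ m, f m ∈ K := by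
  simp [homIdeal, TwoSidedIdeal.mem_mk']

/-- The sum of the images of the members of a two-sided ideal of endomorphisms. -/
noncomputable def idealImage (R : Type u) [Ring R] (M : Type v) [AddCommGroup M] [Module R M]
    (I : TwoSidedIdeal (Module.End R M)) : Submodule R M :=
  LinearMap.range (Finsupp.lsum ℕ (fun f : {f // f ∈ I} => (f : M →ₗ[R] M)))

theorem apply_mem_idealImage (R : Type u) [Ring R] (M : Type v) [AddCommGroup M] [Module R M]
    (I : TwoSidedIdeal (Module.End R M)) (f : Module.End R M) (hf : f ∈ I) (m : M) :
    f m ∈ idealImage R M I :=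
  ⟨Finsupp.single ⟨f, hf⟩ m, by simp⟩

theorem idealImage_le (R : Type u) [Ring R] (M : Type v) [AddCommGroup M] [Module R M]
    (I : TwoSidedIdeal (Module.End R M)) (N : Submodule R M)
    (h : ∀ f ∈ I, ∀ m, f m ∈ N) : idealImage R M I ≤ N := by
  rintro _ ⟨x, rfl⟩
  rw [Finsupp.lsum_apply]
  exact N.sum_mem fun f _ => h f f.2 _

theorem isFullyInvariant_idealImage (R : Type u) [Ring R] (M : Type v) [AddCommGroup M]
    [Module R M] (I : TwoSidedIdeal (Module.End R M)) :
    IsFullyInvariant R M (idealImage R M I) := by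
  intro g
  rw [Submodule.map_le_iff_le_comap]
  exact idealImage_le R M I _ fun f hf m =>
    apply_mem_idealImage R M I (g * f) (I.mul_mem_left g f hf) m

theorem prodM_idealImage_self_eq_bot (R : Type u) [Ring R] (M : Type v) [AddCommGroup M]
    [Module R M] (hproj : ProjectiveInSigmaM R M) (I : TwoSidedIdeal (Module.End R M))
    (hI : ∀ a ∈ I, ∀ b ∈ I, a * b = 0) :
    prodM R M (idealImage R M I) (idealImage R M I) ≤ ⊥ := by
  rw [prodM_le_iff]
  intro g hg
  rw [Submodule.map_le_iff_le_comap]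
  refine idealImage_le R M I _ fun k hk m => ?_
  obtain ⟨h, hh⟩ := hproj _ (idealImage R M I) (inSigmaM_finsupp R M {f // f ∈ I})
    (inSigmaM_submodule_s6 R M _)
    (Finsupp.lsum ℕ (fun f : {f // f ∈ I} => (f : M →ₗ[R] M))).rangeRestrict
    (LinearMap.surjective_rangeRestrict _) (g.codRestrict _ fun m => hg ⟨m, rfl⟩)
  have hgk : Finsupp.lsum ℕ (fun f : {f // f ∈ I} => (f : M →ₗ[R] M)) (h (k m)) = g (k m) :=
    congrArg Subtype.val (LinearMap.congr_fun hh (k m))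
  rw [Submodule.mem_comap, Submodule.mem_bot, ← hgk, Finsupp.lsum_apply]
  refine Finset.sum_eq_zero fun f _ => ?_
  have hfk := hI (f * (Finsupp.lapply f ∘ₗ h : M →ₗ[R] M)) (I.mul_mem_right _ _ f.2) k hk
  exact LinearMap.congr_fun hfk m

/-- For `M` projective in `σ[M]` and retractable: `End_R(M)` is a semiprime
ring iff `M` is a semiprime module. -/
theorem stmt6 (R : Type u) [Ring R] (M : Type v) [AddCommGroup M] [Module R M]
    (hproj : ProjectiveInSigmaM R M) (hret : Retractable R M) :
    IsSemiprimeRing (Module.End R M) ↔ IsSemiprimeModule R M := by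
  constructor
  · intro hS
    refine ⟨fun f => by simp, fun K hK hKK => ?_⟩
    rw [prodM_le_iff] at hKK
    have hbot : homIdeal R M K hK = ⊥ := by
      refine hS _ fun a ha b hb => LinearMap.ext fun m => ?_
      rw [mem_homIdeal] at ha hb
      have hrange : LinearMap.range a ≤ K := by
        rintro _ ⟨x, rfl⟩
        exact ha x
      exact hKK a hrange (Submodule.mem_map_of_mem (hb m))
    by_contra hne
    obtain ⟨f, hf, hf0⟩ := hret K fun h => hne h.le
    have hmem : f ∈ homIdeal R M K hK := (mem_homIdeal R M K hK f).2 fun m => hf ⟨m, rfl⟩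
    rw [hbot] at hmem
    exact hf0 ((TwoSidedIdeal.mem_bot _).1 hmem)
  · intro hM I hI
    have hle := hM.2 _ (isFullyInvariant_idealImage R M I)
      (prodM_idealImage_self_eq_bot R M hproj I hI)
    refine le_bot_iff.1 fun f hf => (TwoSidedIdeal.mem_bot _).2 (LinearMap.ext fun m => ?_)
    exact hle (apply_mem_idealImage R M I f hf m)
end

section
/- Let R be an associative unital ring and M ≠ 0 a left R-module that is semiprime and projective in σ[M]. Then the intersection of all minimal prime submodules of M is the zero submodule. -/
universe u v

/-- The fully invariant submodule generated by an element. -/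
def fullyInvariantSpan (R : Type u) [Ring R] {M : Type v} [AddCommGroup M] [Module R M]
    (a : M) : Submodule R M :=
  Submodule.span R (Set.range fun f : M →ₗ[R] M => f a)

section FullyInvariant

variable {R : Type u} [Ring R] {M : Type v} [AddCommGroup M] [Module R M]

theorem isFullyInvariant_fullyInvariantSpan (a : M) :
    IsFullyInvariant R M (fullyInvariantSpan R a) := by
  intro g
  rw [fullyInvariantSpan, Submodule.map_span, Submodule.span_le]
  rintro _ ⟨_, ⟨f, rfl⟩, rfl⟩
  exact Submodule.subset_span ⟨g ∘ₗ f, rfl⟩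

theorem mem_fullyInvariantSpan (a : M) : a ∈ fullyInvariantSpan R a :=
  Submodule.subset_span ⟨LinearMap.id, rfl⟩

theorem IsFullyInvariant.apply_mem {K : Submodule R M} (hK : IsFullyInvariant R M K)
    (f : M →ₗ[R] M) {a : M} (ha : a ∈ K) : f a ∈ K :=
  hK f (Submodule.mem_map_of_mem ha)

theorem IsFullyInvariant.fullyInvariantSpan_le {K : Submodule R M}
    (hK : IsFullyInvariant R M K) {a : M} (ha : a ∈ K) : fullyInvariantSpan R a ≤ K := by
  rw [fullyInvariantSpan, Submodule.span_le]
  rintro _ ⟨f, rfl⟩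
  exact hK.apply_mem f ha

theorem IsFullyInvariant.sup {K L : Submodule R M} (hK : IsFullyInvariant R M K)
    (hL : IsFullyInvariant R M L) : IsFullyInvariant R M (K ⊔ L) := fun f => by
  rw [Submodule.map_sup]
  exact sup_le_sup (hK f) (hL f)

theorem IsFullyInvariant.sInf {c : Set (Submodule R M)}
    (hc : ∀ K ∈ c, IsFullyInvariant R M K) : IsFullyInvariant R M (sInf c) := fun f =>
  le_sInf fun K hK => (Submodule.map_mono (sInf_le hK)).trans (hc K hK f)

theorem IsFullyInvariant.sSup {c : Set (Submodule R M)}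
    (hc : ∀ K ∈ c, IsFullyInvariant R M K) : IsFullyInvariant R M (sSup c) := fun f => by
  rw [Submodule.map_le_iff_le_comap]
  exact sSup_le fun K hK =>
    Submodule.map_le_iff_le_comap.1 ((hc K hK f).trans (le_sSup hK))

theorem prodM_mono {K K' L L' : Submodule R M} (hK : K ≤ K') (hL : L ≤ L') :
    prodM R M K L ≤ prodM R M K' L' :=
  iSup₂_le fun f hf =>
    (Submodule.map_mono hK).trans (le_iSup₂_of_le f (hf.trans hL) le_rfl)

theorem IsFullyInvariant.prodM_le_left {K : Submodule R M} (hK : IsFullyInvariant R M K)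
    (L : Submodule R M) : prodM R M K L ≤ K :=
  iSup₂_le fun f _ => hK f

/-- If `M` is projective in `σ[M]`, a map into a sum of submodules splits as a sum of maps. -/
theorem ProjectiveInSigmaM.exists_add_eq (hproj : ProjectiveInSigmaM R M)
    {L P : Submodule R M} (f : M →ₗ[R] M) (hf : LinearMap.range f ≤ L ⊔ P) :
    ∃ g h : M →ₗ[R] M, LinearMap.range g ≤ L ∧ LinearMap.range h ≤ P ∧ f = g + h := by
  have hM : IsMGenerated R M M := ⟨PUnit, Finsupp.lapply PUnit.unit, fun m =>
    ⟨Finsupp.single PUnit.unit m, by simp⟩⟩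
  have hMM : IsMGenerated R M (M × M) := by
    refine ⟨ULift Bool, (Finsupp.lapply ⟨true⟩).prod (Finsupp.lapply ⟨false⟩), ?_⟩
    rintro ⟨x, y⟩
    exact ⟨Finsupp.single ⟨true⟩ x + Finsupp.single ⟨false⟩ y, by simp⟩
  let s : (L × P) →ₗ[R] (L ⊔ P : Submodule R M) :=
    (Submodule.inclusion le_sup_left).coprod (Submodule.inclusion le_sup_right)
  have hs : Function.Surjective s := by
    rintro ⟨x, hx⟩
    obtain ⟨y, hy, z, hz, rfl⟩ := Submodule.mem_sup.1 hx
    exact ⟨(⟨y, hy⟩, ⟨z, hz⟩), Subtype.ext (by simp [s])⟩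
  obtain ⟨k, hk⟩ := hproj (L × P) (L ⊔ P : Submodule R M)
    ⟨M × M, inferInstance, inferInstance, hMM, L.subtype.prodMap P.subtype,
      Function.Injective.prodMap L.injective_subtype P.injective_subtype⟩
    ⟨M, inferInstance, inferInstance, hM, (L ⊔ P).subtype, Submodule.injective_subtype _⟩
    s hs (f.codRestrict _ fun x => hf ⟨x, rfl⟩)
  refine ⟨L.subtype ∘ₗ LinearMap.fst R L P ∘ₗ k, P.subtype ∘ₗ LinearMap.snd R L P ∘ₗ k,
    ?_, ?_, ?_⟩
  · rintro _ ⟨x, rfl⟩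
    exact (k x).1.2
  · rintro _ ⟨x, rfl⟩
    exact (k x).2.2
  · ext x
    have := congrArg Subtype.val (LinearMap.congr_fun hk x)
    simpa [s] using this.symm

theorem ProjectiveInSigmaM.prodM_sup_sup_le (hproj : ProjectiveInSigmaM R M)
    {P : Submodule R M} (hP : IsFullyInvariant R M P) (K L : Submodule R M) :
    prodM R M (K ⊔ P) (L ⊔ P) ≤ prodM R M K L ⊔ P := by
  refine iSup₂_le fun f hf => ?_
  rw [Submodule.map_sup]
  refine sup_le ?_ ((hP f).trans le_sup_right)
  obtain ⟨g, h, hg, hh, rfl⟩ := hproj.exists_add_eq f hf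
  refine (Submodule.map_add_le K g h).trans (sup_le_sup ?_ ?_)
  · exact le_iSup₂_of_le g hg le_rfl
  · exact LinearMap.map_le_range.trans hh

/-- In a semiprime module projective in `σ[M]`, every nonzero element is avoided by a prime
submodule. -/
theorem IsSemiprimeModule.exists_isPrimeSubmodule_notMem (hproj : ProjectiveInSigmaM R M)
    (hsemi : IsSemiprimeModule R M) {x : M} (hx : x ≠ 0) :
    ∃ P : Submodule R M, IsPrimeSubmodule R M P ∧ x ∉ P := by
  have step (a : {a : M // a ≠ 0}) : ∃ b : {b : M // b ≠ 0},
      (b : M) ∈ prodM R M (fullyInvariantSpan R (a : M)) (fullyInvariantSpan R (a : M)) := by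
    by_contra! h
    refine a.2 ((Submodule.mem_bot R).1 (hsemi.2 _ (isFullyInvariant_fullyInvariantSpan _) ?_
      (mem_fullyInvariantSpan (R := R) (a : M))))
    intro b hb
    by_contra hb0
    exact h ⟨b, hb0⟩ hb
  choose next hnext using step
  let a : ℕ → {a : M // a ≠ 0} := fun n => next^[n] ⟨x, hx⟩
  have ha (n : ℕ) : (a (n + 1) : M) ∈
      prodM R M (fullyInvariantSpan R (a n : M)) (fullyInvariantSpan R (a n : M)) := by
    simp only [a, Function.iterate_succ_apply']
    exact hnext _
  have anti : Antitone fun n => fullyInvariantSpan R (a n : M) :=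
    antitone_nat_of_succ_le fun n =>
      (isFullyInvariant_fullyInvariantSpan _).fullyInvariantSpan_le
        ((isFullyInvariant_fullyInvariantSpan _).prodM_le_left _ (ha n))
  obtain ⟨P, -, hP⟩ := zorn_le_nonempty₀
    {P : Submodule R M | IsFullyInvariant R M P ∧ ∀ n, (a n : M) ∉ P}
    (fun c hc hchain y hy => ⟨sSup c, ⟨IsFullyInvariant.sSup fun K hK => (hc hK).1,
      fun n hn => by
        obtain ⟨K, hK, hnK⟩ :=
          (Submodule.mem_sSup_of_directed ⟨y, hy⟩ hchain.directedOn).1 hn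
        exact (hc hK).2 n hnK⟩, fun K hK => le_sSup hK⟩)
    ⊥ ⟨fun f => by simp, fun n hn => (a n).2 ((Submodule.mem_bot R).1 hn)⟩
  have meets {K : Submodule R M} (hK : IsFullyInvariant R M K) (hKP : ¬K ≤ P) :
      ∃ n, fullyInvariantSpan R (a n : M) ≤ K ⊔ P := by
    have hsup := hK.sup hP.prop.1
    by_contra! h
    exact hKP (le_sup_left.trans (hP.le_of_ge
      ⟨hsup, fun n hn => h n (hsup.fullyInvariantSpan_le hn)⟩ le_sup_right))
  refine ⟨P, ⟨hP.prop.1, fun K L hK hL hKL => ?_⟩, hP.prop.2 0⟩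
  by_contra! h
  obtain ⟨i, hi⟩ := meets hK h.1
  obtain ⟨j, hj⟩ := meets hL h.2
  have hmul := (prodM_mono ((anti (le_max_left i j)).trans hi)
    ((anti (le_max_right i j)).trans hj)).trans (hproj.prodM_sup_sup_le hP.prop.1 K L)
  exact hP.prop.2 _ (sup_le hKL le_rfl (hmul (ha (max i j))))

theorem isPrimeSubmodule_sInf_of_isChain {c : Set (Submodule R M)}
    (hc : ∀ P ∈ c, IsPrimeSubmodule R M P) (hchain : IsChain (· ≤ ·) c) :
    IsPrimeSubmodule R M (sInf c) := by
  refine ⟨IsFullyInvariant.sInf fun P hP => (hc P hP).1, fun K L hK hL hKL => ?_⟩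
  by_contra! h
  simp only [le_sInf_iff, not_forall] at h
  obtain ⟨⟨P, hP, hKP⟩, ⟨Q, hQ, hLQ⟩⟩ := h
  rcases hchain.total hP hQ with hPQ | hQP
  · exact ((hc P hP).2 K L hK hL (hKL.trans (sInf_le hP))).elim hKP
      fun hLP => hLQ (hLP.trans hPQ)
  · exact ((hc Q hQ).2 K L hK hL (hKL.trans (sInf_le hQ))).elim
      (fun hKQ => hKP (hKQ.trans hQP)) hLQ

theorem IsPrimeSubmodule.exists_isMinimalPrimeSubmodule_le {P : Submodule R M}
    (hP : IsPrimeSubmodule R M P) : ∃ Q ≤ P, IsMinimalPrimeSubmodule R M Q := by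
  obtain ⟨Q, hQP, hQ⟩ := zorn_le_nonempty₀ (α := (Submodule R M)ᵒᵈ)
    {Q | IsPrimeSubmodule R M (OrderDual.ofDual Q)}
    (fun c hc hchain _ _ => ⟨OrderDual.toDual (sInf (OrderDual.toDual ⁻¹' c)),
      isPrimeSubmodule_sInf_of_isChain (fun K hK => hc hK) hchain.symm,
      fun K hK => sInf_le (α := Submodule R M) hK⟩)
    (OrderDual.toDual P) hP
  exact ⟨OrderDual.ofDual Q, hQP, hQ.prop, fun K hK hKQ =>
    le_antisymm hKQ (hQ.le_of_ge (y := OrderDual.toDual K) hK hKQ)⟩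

end FullyInvariant

/-- For a nonzero semiprime module projective in `σ[M]`, the intersection
of all minimal prime submodules is zero. -/
theorem stmt10 (R : Type u) [Ring R] (M : Type v) [AddCommGroup M] [Module R M]
    [Nontrivial M] (hproj : ProjectiveInSigmaM R M) (hsemi : IsSemiprimeModule R M) :
    sInf {P : Submodule R M | IsMinimalPrimeSubmodule R M P} = ⊥ := by
  refine (Submodule.eq_bot_iff _).2 fun x hx => ?_
  by_contra hx0
  obtain ⟨P, hP, hxP⟩ := hsemi.exists_isPrimeSubmodule_notMem hproj hx0
  obtain ⟨Q, hQP, hQ⟩ := hP.exists_isMinimalPrimeSubmodule_le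
  exact hxP (hQP (Submodule.mem_sInf.1 hx Q hQ))
end
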